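/- Let u be a smooth real function of x and let K = -(1/4)∂³ + ∂ ∘ u ∘ ∂⁻¹ ∘ u ∘ ∂ be the Lenard operator. Then the three functions G¹ = ∫ e^{-2∫u}, G² = ∫ e^{2∫u}, and G³ = (∫ e^{-2∫u})·(∫ e^{2∫u}) all lie in the kernel of K, i.e., K·Gᵏ = 0 for k = 1,2,3. -/

import Mathlib

open Filter Topology Set in
lemma aux_mvt {E p : ℝ → ℝ} (hE : ∀ x, HasDerivAt E (p x) x) (x : ℝ) :
    NeBot (𝓝[>] x ⊓ comap p (𝓝 (p x))) ∧ NeBot (𝓝[<] x ⊓ comap p (𝓝 (p x))) := by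
  have hs := hasDerivAt_iff_tendsto_slope.1 (hE x)
  have hc : Continuous E := continuous_iff_continuousAt.2 fun y => (hE y).continuousAt
  constructor
  · rw [inf_neBot_iff_frequently_right]
    intro P hP
    obtain ⟨V, hV, hVP⟩ := hP
    have h1 : ∀ᶠ y in 𝓝[>] x, slope E x y ∈ V :=
      (hs.mono_left (nhdsWithin_mono _ fun y hy => ne_of_gt hy)) hV
    rw [frequently_iff]
    intro S hS
    obtain ⟨c, hc1, hc2⟩ := (mem_nhdsGT_iff_exists_Ioo_subset).1 (inter_mem h1 hS)
    have hxc : x < (x + c) / 2 := by have : x < c := hc1; linarith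
    have hcc : (x + c) / 2 < c := by have : x < c := hc1; linarith
    obtain ⟨z, hz, hz2⟩ := exists_hasDerivAt_eq_slope E p hxc hc.continuousOn fun y _ => hE y
    refine ⟨z, (hc2 ⟨hz.1, hz.2.trans hcc⟩).2, hVP ?_⟩
    have := (hc2 ⟨hxc, hcc⟩).1
    simp only [mem_preimage, hz2]
    simpa [slope_def_field] using this
  · rw [inf_neBot_iff_frequently_right]
    intro P hP
    obtain ⟨V, hV, hVP⟩ := hP
    have h1 : ∀ᶠ y in 𝓝[<] x, slope E x y ∈ V :=
      (hs.mono_left (nhdsWithin_mono _ fun y hy => ne_of_lt hy)) hV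
    rw [frequently_iff]
    intro S hS
    obtain ⟨c, hc1, hc2⟩ := (mem_nhdsLT_iff_exists_Ioo_subset).1 (inter_mem h1 hS)
    have hxc : (x + c) / 2 < x := by have : c < x := hc1; linarith
    have hcc : c < (x + c) / 2 := by have : c < x := hc1; linarith
    obtain ⟨z, hz, hz2⟩ := exists_hasDerivAt_eq_slope E p hxc hc.continuousOn fun y _ => hE y
    refine ⟨z, (hc2 ⟨hcc.trans hz.1, hz.2⟩).2, hVP ?_⟩
    have : slope E x ((x + c) / 2) ∈ V := (hc2 ⟨hcc, hxc⟩).1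
    simp only [mem_preimage, hz2]
    rw [slope_comm] at this
    simpa [slope_def_field] using this

open Filter Topology Set in
lemma aux_darboux {E p : ℝ → ℝ} (hE : ∀ x, HasDerivAt E (p x) x) (x : ℝ)
    (hn : ¬ ContinuousAt p x) :
    ∃ e0 > 0, ∀ e, 0 < e → e < e0 →
      (∃ᶠ y in 𝓝 x, p y = p x + e) ∨ (∃ᶠ y in 𝓝 x, p y = p x - e) := by
  rw [Metric.continuousAt_iff'] at hn
  push Not at hn
  obtain ⟨e0, he0, hf⟩ := hn
  refine ⟨e0, he0, fun e he hee => ?_⟩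
  rw [← frequently_or_distrib, Metric.nhds_basis_ball.frequently_iff]
  intro d hd
  obtain ⟨y, hy, hye⟩ := (Metric.nhds_basis_ball.frequently_iff.1 hf) d hd
  have hoc : OrdConnected (p '' (Metric.ball x d)) := by
    rw [Real.ball_eq_Ioo]
    exact ordConnected_Ioo.image_hasDerivWithinAt fun z _ => (hE z).hasDerivWithinAt
  have hxm : p x ∈ p '' (Metric.ball x d) := ⟨x, Metric.mem_ball_self hd, rfl⟩
  have hym : p y ∈ p '' (Metric.ball x d) := ⟨y, hy, rfl⟩
  rw [Real.dist_eq, le_abs] at hye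
  rcases hye with h | h
  · obtain ⟨z, hz, hz2⟩ := hoc.out hxm hym (show p x + e ∈ Icc _ _ from ⟨by linarith, by linarith⟩)
    exact ⟨z, hz, Or.inl hz2⟩
  · obtain ⟨z, hz, hz2⟩ := hoc.out hym hxm (show p x - e ∈ Icc _ _ from ⟨by linarith, by linarith⟩)
    exact ⟨z, hz, Or.inr hz2⟩

open Filter Topology Set in
lemma aux_key {E₁ E₂ p : ℝ → ℝ} (hp : ∀ x, 0 < p x) (hE₁ : ∀ x, HasDerivAt E₁ (p x) x)
    (hE₂ : ∀ x, HasDerivAt E₂ (p x)⁻¹ x) (s x L : ℝ)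
    (hf : HasDerivAt (fun y => p y * E₂ y + s * (E₁ y * (p y)⁻¹)) L x)
    (hnd : ¬ DifferentiableAt ℝ p x) : L = 1 + s := by
  have hpx := hp x
  set F : ℝ → ℝ := fun y => slope (fun y => p y * E₂ y + s * (E₁ y * (p y)⁻¹)) x y
    - (p y * slope E₂ x y + s * (slope E₁ x y * (p y)⁻¹)) with hF
  have hFeq : ∀ y, y ≠ x → F y = (p y - p x) * (E₂ x - s * E₁ x / (p y * p x)) / (y - x) := by
    intro y hy
    have h1 : y - x ≠ 0 := sub_ne_zero.2 hy
    have := (hp y).ne'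
    simp only [hF, slope_def_field]
    field_simp
    ring
  have hlim : ∀ l : Filter ℝ, l ≤ 𝓝[≠] x → Tendsto p l (𝓝 (p x)) →
      Tendsto F l (𝓝 (L - (1 + s))) := by
    intro l hl hpl
    have a1 := (hasDerivAt_iff_tendsto_slope.1 hf).mono_left hl
    have a2 := (hasDerivAt_iff_tendsto_slope.1 (hE₁ x)).mono_left hl
    have a3 := (hasDerivAt_iff_tendsto_slope.1 (hE₂ x)).mono_left hl
    have := a1.sub ((hpl.mul a3).add ((a2.mul (hpl.inv₀ hpx.ne')).const_mul s))
    have e : L - (p x * (p x)⁻¹ + s * (p x * (p x)⁻¹)) = L - (1 + s) := by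
      field_simp
    rwa [e] at this
  by_cases hdeg : E₂ x * p x ^ 2 = s * E₁ x
  · obtain ⟨n1, n2⟩ := aux_mvt hE₁ x
    have t1 := hlim (𝓝[>] x ⊓ comap p (𝓝 (p x)))
      (inf_le_left.trans (nhdsWithin_mono _ fun y hy => ne_of_gt hy))
      (tendsto_comap.mono_left inf_le_right)
    have t2 := hlim (𝓝[<] x ⊓ comap p (𝓝 (p x)))
      (inf_le_left.trans (nhdsWithin_mono _ fun y hy => ne_of_lt hy))
      (tendsto_comap.mono_left inf_le_right)
    have hF2 : ∀ y, y ≠ x → F y = E₂ x * ((p y - p x) ^ 2 / p y) / (y - x) := by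
      intro y hy
      rw [hFeq y hy, ← hdeg]
      have h1 : y - x ≠ 0 := sub_ne_zero.2 hy
      have := (hp y).ne'
      field_simp
    by_cases hb : E₂ x = 0
    · have : Tendsto F (𝓝[>] x ⊓ comap p (𝓝 (p x))) (𝓝 0) := by
        refine tendsto_const_nhds.congr' ?_
        filter_upwards [inf_le_left (a := 𝓝[>] x) self_mem_nhdsWithin] with y hy
        rw [hF2 y (ne_of_gt hy), hb]; simp
      have := tendsto_nhds_unique t1 this
      linarith
    · have g1 : 0 ≤ E₂ x * (L - (1 + s)) := by
        refine ge_of_tendsto (t1.const_mul (E₂ x)) ?_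
        filter_upwards [inf_le_left (a := 𝓝[>] x) self_mem_nhdsWithin] with y hy
        have hy : x < y := hy
        have h1 : 0 < y - x := sub_pos.2 hy
        have := hp y
        rw [hF2 y (ne_of_gt hy)]
        have e : E₂ x * (E₂ x * ((p y - p x) ^ 2 / p y) / (y - x)) =
          E₂ x ^ 2 * ((p y - p x) ^ 2 / p y) / (y - x) := by ring
        rw [e]; positivity
      have g2 : E₂ x * (L - (1 + s)) ≤ 0 := by
        refine le_of_tendsto (t2.const_mul (E₂ x)) ?_
        filter_upwards [inf_le_left (a := 𝓝[<] x) self_mem_nhdsWithin] with y hy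
        have hy : y < x := hy
        have := hp y
        rw [hF2 y (ne_of_lt hy)]
        have e : E₂ x * (E₂ x * ((p y - p x) ^ 2 / p y) / (y - x)) =
          E₂ x ^ 2 * ((p y - p x) ^ 2 / p y) / (y - x) := by ring
        rw [e]
        exact div_nonpos_of_nonneg_of_nonpos (by positivity) (by linarith)
      have := le_antisymm g2 g1
      rcases mul_eq_zero.1 this with h | h
      · exact absurd h hb
      · linarith
  · exfalso
    have hcont : ContinuousAt p x := by
      by_contra hn
      obtain ⟨e0, he0, hd⟩ := aux_darboux hE₁ x hn
      have hval : ∀ r, 0 < r → r ≠ p x → (∃ᶠ y in 𝓝 x, p y = r) →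
          E₂ x * p x * r = s * E₁ x := by
        intro r hr hrp hfr
        have : NeBot (𝓝 x ⊓ 𝓟 {y | p y = r}) := frequently_mem_iff_neBot.1 hfr
        have a1 : Tendsto (fun y => p y * E₂ y + s * (E₁ y * (p y)⁻¹)) (𝓝 x ⊓ 𝓟 {y | p y = r})
            (𝓝 (p x * E₂ x + s * (E₁ x * (p x)⁻¹))) :=
          Tendsto.mono_left hf.continuousAt inf_le_left
        have b1 : Tendsto E₁ (𝓝 x ⊓ 𝓟 {y | p y = r}) (𝓝 (E₁ x)) :=
          Tendsto.mono_left (hE₁ x).continuousAt inf_le_left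
        have b2 : Tendsto E₂ (𝓝 x ⊓ 𝓟 {y | p y = r}) (𝓝 (E₂ x)) :=
          Tendsto.mono_left (hE₂ x).continuousAt inf_le_left
        have a2 : Tendsto (fun y => p y * E₂ y + s * (E₁ y * (p y)⁻¹)) (𝓝 x ⊓ 𝓟 {y | p y = r})
            (𝓝 (r * E₂ x + s * (E₁ x * r⁻¹))) := by
          refine ((b2.const_mul r).add ((b1.mul_const r⁻¹).const_mul s)).congr' ?_
          filter_upwards [inf_le_right (a := 𝓝 x) (mem_principal_self _)] with y hy
          have hy : p y = r := hy
          rw [hy]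
        have h := tendsto_nhds_unique a1 a2
        have hsub : r - p x ≠ 0 := sub_ne_zero.2 hrp
        apply mul_left_cancel₀ hsub
        field_simp at h
        linear_combination -h
      have hcts : ∀ r : ℝ → ℝ, Continuous r → r 0 = p x → ∀ᶠ e in 𝓝 (0:ℝ),
          0 < r e ∧ E₂ x * p x * r e ≠ s * E₁ x := by
        intro r hr h0
        have hpos : ∀ᶠ e in 𝓝 (0:ℝ), 0 < r e :=
          hr.continuousAt.eventually_const_lt (by rw [h0]; exact hpx)
        refine hpos.and ?_
        have hc : ContinuousAt (fun e => E₂ x * p x * r e) 0 := by fun_prop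
        apply hc.eventually_ne
        rw [h0]
        intro h; apply hdeg; rw [← h]; ring
      have h1 := hcts (fun e => p x + e) (by fun_prop) (by simp)
      have h2 := hcts (fun e => p x - e) (by fun_prop) (by simp)
      have h3 : ∀ᶠ e in 𝓝 (0:ℝ), e < e0 := eventually_lt_nhds he0
      have h4 := ((h1.and h2).and h3).filter_mono (nhdsWithin_le_nhds (s := Ioi 0))
      obtain ⟨e, ⟨⟨⟨i1, i2⟩, i3, i4⟩, i5⟩, i6⟩ := (h4.and self_mem_nhdsWithin).exists
      have i6 : 0 < e := i6
      rcases hd e i6 i5 with h | h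
      · exact i2 (hval _ i1 (by linarith) h)
      · exact i4 (hval _ i3 (by linarith) h)
    apply hnd
    have hpt : Tendsto p (𝓝[≠] x) (𝓝 (p x)) := Tendsto.mono_left hcont nhdsWithin_le_nhds
    have t := hlim _ le_rfl hpt
    have hden : E₂ x - s * E₁ x / (p x * p x) ≠ 0 := by
      intro h; apply hdeg; field_simp at h; linarith
    have td : Tendsto (fun y => E₂ x - s * E₁ x / (p y * p x)) (𝓝[≠] x)
        (𝓝 (E₂ x - s * E₁ x / (p x * p x))) :=
      tendsto_const_nhds.sub (tendsto_const_nhds.div (hpt.mul_const _) (by positivity))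
    refine (hasDerivAt_iff_tendsto_slope.2 ((t.div td hden).congr' ?_)).differentiableAt
    filter_upwards [self_mem_nhdsWithin, td.eventually_ne hden] with y hy hy2
    have h1 : y - x ≠ 0 := sub_ne_zero.2 hy
    simp only [Pi.div_apply]
    rw [hFeq y hy, slope_def_field]
    rw [div_right_comm, mul_div_cancel_right₀ _ hy2]

open Filter Topology Set in
lemma aux_iso {E₁ U u : ℝ → ℝ} (hu : Continuous u) (hU : ∀ x, deriv U x = u x)
    (hE₁ : ∀ x, HasDerivAt E₁ (Real.exp (-(2 * U x))) x) (x : ℝ)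
    (hx : ∀ᶠ y in 𝓝[≠] x, u y ≠ 0) : ∀ᶠ y in 𝓝 x, DifferentiableAt ℝ U y := by
  set V : ℝ → ℝ := fun y => ∫ t in (0:ℝ)..y, u t
  have hV : ∀ y, HasDerivAt V (u y) y := fun y => hu.integral_hasStrictDerivAt 0 y |>.hasDerivAt
  have hd : ∀ y, u y ≠ 0 → HasDerivAt (fun z => U z - V z) 0 y := by
    intro y hy
    have : DifferentiableAt ℝ U y := differentiableAt_of_deriv_ne_zero (by rw [hU]; exact hy)
    have h := this.hasDerivAt.sub (hV y)
    rw [hU, sub_self] at h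
    exact h
  have hUt : Tendsto U (comap (fun y => Real.exp (-(2 * U y))) (𝓝 (Real.exp (-(2 * U x)))))
      (𝓝 (U x)) := by
    have h1 : Tendsto (fun y => Real.exp (-(2 * U y)))
      (comap (fun y => Real.exp (-(2 * U y))) (𝓝 (Real.exp (-(2 * U x))))) _ := tendsto_comap
    have h2 := (h1.log (Real.exp_pos _).ne').const_mul (-(1/2))
    simp only [Real.log_exp] at h2
    have e : ∀ a : ℝ, -(1/2) * -(2 * a) = a := fun a => by ring
    simpa only [e] using h2
  have hloc : ∀ (l : Filter ℝ) (S : Set ℝ), l ≤ 𝓝 x → S ∈ l → IsOpen S → IsPreconnected S →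
      (∀ y ∈ S, u y ≠ 0) → NeBot (l ⊓ comap (fun y => Real.exp (-(2 * U y)))
        (𝓝 (Real.exp (-(2 * U x))))) → ∀ y ∈ S, U y - V y = U x - V x := by
    intro l S hl hS ho hc hS0 hne y hy
    have t : Tendsto (fun z => U z - V z) (l ⊓ comap (fun y => Real.exp (-(2 * U y)))
        (𝓝 (Real.exp (-(2 * U x))))) (𝓝 (U x - V x)) :=
      (hUt.mono_left inf_le_right).sub
        (Tendsto.mono_left (hV x).continuousAt (inf_le_left.trans hl))
    refine tendsto_nhds_unique (tendsto_const_nhds.congr' ?_) t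
    filter_upwards [inf_le_left (a := l) hS] with z hz
    exact ho.is_const_of_deriv_eq_zero hc
      (fun w hw => (hd w (hS0 w hw)).differentiableAt.differentiableWithinAt)
      (fun w hw => (hd w (hS0 w hw)).deriv) hy hz
  obtain ⟨n1, n2⟩ := aux_mvt hE₁ x
  rw [eventually_nhdsWithin_iff, Metric.eventually_nhds_iff_ball] at hx
  obtain ⟨d, hd0, hx⟩ := hx
  rw [Real.ball_eq_Ioo] at hx
  have r1 := hloc (𝓝[>] x) (Ioo x (x + d)) nhdsWithin_le_nhds (Ioo_mem_nhdsGT (by linarith))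
    isOpen_Ioo isPreconnected_Ioo
    (fun y hy => hx y ⟨by linarith [hy.1], hy.2⟩ (ne_of_gt hy.1)) n1
  have r2 := hloc (𝓝[<] x) (Ioo (x - d) x) nhdsWithin_le_nhds (Ioo_mem_nhdsLT (by linarith))
    isOpen_Ioo isPreconnected_Ioo
    (fun y hy => hx y ⟨hy.1, by linarith [hy.2]⟩ (ne_of_lt hy.2)) n2
  have hev : ∀ y ∈ Ioo (x - d) (x + d), U y = V y + (U x - V x) := by
    intro y hy
    rcases lt_trichotomy y x with h | h | h
    · linarith [r2 y ⟨hy.1, h⟩]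
    · subst h; ring
    · linarith [r1 y ⟨h, hy.2⟩]
  filter_upwards [Ioo_mem_nhds (show x - d < x by linarith) (show x < x + d by linarith)] with y hy
  have : DifferentiableAt ℝ (fun y => V y + (U x - V x)) y :=
    (hV y).differentiableAt.add_const _
  refine this.congr_of_eventuallyEq ?_
  filter_upwards [Ioo_mem_nhds hy.1 hy.2] with z hz using hev z hz

lemma aux_diff {U : ℝ → ℝ} {c x : ℝ} (hc : c ≠ 0)
    (h : DifferentiableAt ℝ (fun y => Real.exp (c * U y)) x) : DifferentiableAt ℝ U x := by
  have h2 := (h.log (Real.exp_pos _).ne').const_mul c⁻¹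
  simp only [Real.log_exp] at h2
  have e : ∀ a : ℝ, c⁻¹ * (c * a) = a := fun a => by field_simp
  simpa only [e] using h2

lemma aux_exp {U u : ℝ → ℝ} (hU : ∀ x, deriv U x = u x) (c : ℝ) (hc : c ≠ 0) (x : ℝ) :
    deriv (fun y => Real.exp (c * U y)) x = c * u x * Real.exp (c * U x) := by
  by_cases h : DifferentiableAt ℝ U x
  · have := (h.hasDerivAt.const_mul c).exp.deriv
    rw [this, hU]; ring
  · rw [deriv_zero_of_not_differentiableAt (fun h' => h (aux_diff hc h')), ← hU,
      deriv_zero_of_not_differentiableAt h]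
    ring

lemma aux_first {U u E : ℝ → ℝ} (hU : ∀ x, deriv U x = u x) (c : ℝ) (hc : c ^ 2 = 4)
    (hE : ∀ x, deriv E x = Real.exp (c * U x)) :
    ∃ W : ℝ → ℝ, (∀ x, deriv W x = u x * deriv E x) ∧
      ∀ x, -(1 / 4) * deriv (deriv (deriv E)) x + deriv (fun y => u y * W y) x = 0 := by
  have hc0 : c ≠ 0 := by rintro rfl; norm_num at hc
  refine ⟨fun y => (c / 4) * Real.exp (c * U y), fun x => ?_, fun x => ?_⟩
  · rw [deriv_const_mul_field, aux_exp hU c hc0, hE]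
    linear_combination (u x * Real.exp (c * U x) / 4) * hc
  · have h1 : deriv E = fun y => Real.exp (c * U y) := funext hE
    have h2 : deriv (deriv E) = fun y => c * (u y * Real.exp (c * U y)) := by
      rw [h1]; funext y; rw [aux_exp hU c hc0]; ring
    have h3 : (fun y => u y * (c / 4 * Real.exp (c * U y))) =
      fun y => (c / 4) * (u y * Real.exp (c * U y)) := by funext y; ring
    rw [h2, h3, deriv_const_mul_field, deriv_const_mul_field]; ring

open Filter Topology Set in
lemma aux_third (u U E₁ E₂ : ℝ → ℝ) (hu : Continuous u) (hU : ∀ x, deriv U x = u x)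
    (hE₁ : ∀ x, HasDerivAt E₁ (Real.exp (-(2 * U x))) x)
    (hE₂ : ∀ x, HasDerivAt E₂ (Real.exp (-(2 * U x)))⁻¹ x) :
    (∃ W : ℝ → ℝ, (∀ x, deriv W x = u x * deriv (fun y => E₁ y * E₂ y) x) ∧
      ∀ x, -(1 / 4) * deriv (deriv (deriv (fun y => E₁ y * E₂ y))) x
          + deriv (fun y => u y * W y) x = 0) := by
  set p : ℝ → ℝ := fun y => Real.exp (-(2 * U y)) with hp
  have hp0 : ∀ y, 0 < p y := fun y => Real.exp_pos _
  set f : ℝ → ℝ → ℝ := fun s y => p y * E₂ y + s * (E₁ y * (p y)⁻¹) with hf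
  have hG : deriv (fun y => E₁ y * E₂ y) = f 1 := by
    funext y
    rw [((hE₁ y).fun_mul (hE₂ y)).deriv]; simp [hf, hp]
  have hnd : ∀ x, ¬ DifferentiableAt ℝ U x → ¬ DifferentiableAt ℝ p x := by
    intro x h h'
    refine h (aux_diff (c := -2) (by norm_num) ?_)
    simpa [hp] using h'
  have hu0 : ∀ x, ¬ DifferentiableAt ℝ U x → u x = 0 := by
    intro x h
    rw [← hU, deriv_zero_of_not_differentiableAt h]
  have hder : ∀ s x, DifferentiableAt ℝ U x →
      deriv (f s) x = -2 * u x * f (-s) x + (1 + s) := by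
    intro s x h
    have hpd : HasDerivAt p (-2 * u x * p x) x := by
      have := ((h.hasDerivAt.const_mul 2).fun_neg).exp
      rw [hU] at this
      convert this using 1
      simp [hp]; ring
    have := ((hpd.fun_mul (hE₂ x)).fun_add (((hE₁ x).fun_mul (hpd.fun_inv (hp0 x).ne')).const_mul s))
    have h2 := this.deriv
    have h3 := (hp0 x).ne'
    change deriv (f s) x = _ at h2
    rw [h2]
    change _ * E₂ x + p x * (p x)⁻¹ + s * (p x * (p x)⁻¹ + _) = _
    simp only [hf]
    field_simp
    ring
  have hderN : ∀ s x, ¬ DifferentiableAt ℝ U x →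
      deriv (f s) x = 0 ∨ deriv (f s) x = 1 + s := by
    intro s x h
    by_cases hd : DifferentiableAt ℝ (f s) x
    · right
      exact aux_key hp0 hE₁ hE₂ s x _ hd.hasDerivAt (hnd x h)
    · left; exact deriv_zero_of_not_differentiableAt hd
  rw [hG]
  refine ⟨fun y => -(1/2) * f (-1) y, fun x => ?_, fun x => ?_⟩
  · rw [deriv_const_mul_field]
    by_cases h : DifferentiableAt ℝ U x
    · rw [hder _ _ h]; simp; ring
    · rw [hu0 x h]
      rcases hderN (-1) x h with h | h <;> rw [h] <;> simp
  · set g := deriv (f 1) with hg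
    set h : ℝ → ℝ := fun y => u y * (-(1/2) * f (-1) y) with hh
    have hgD : ∀ y, DifferentiableAt ℝ U y → g y = 4 * h y + 2 := by
      intro y hy
      rw [hg, hder 1 y hy]; simp only [hh]; ring
    have hg0 : ∀ y, u y = 0 → g y = 0 ∨ g y = 2 := by
      intro y hy
      by_cases hD : DifferentiableAt ℝ U y
      · right; rw [hgD y hD]; simp [hh, hy]
      · have := hderN 1 y hD
        norm_num at this; exact this
    by_cases hev : ∀ᶠ y in 𝓝 x, DifferentiableAt ℝ U y
    · have e : g =ᶠ[𝓝 x] fun y => 4 * h y + 2 := hev.mono hgD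
      rw [e.deriv_eq, deriv_add_const, deriv_const_mul_field]; ring
    · have hni : ¬ ∀ᶠ y in 𝓝[≠] x, u y ≠ 0 := fun h' => hev (aux_iso hu hU hE₁ x h')
      have hux : u x = 0 := by
        by_contra hc
        exact hni ((hu.continuousAt.eventually_ne hc).filter_mono nhdsWithin_le_nhds)
      have d1 : deriv h x = 0 := by
        by_contra hc
        have := (differentiableAt_of_deriv_ne_zero hc).hasDerivAt.eventually_ne (c := 0) hc
        refine hni (this.mono fun y hy hy' => hy ?_)
        simp [hh, hy']
      have d2 : deriv g x = 0 := by
        by_contra hc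
        have hd := differentiableAt_of_deriv_ne_zero hc
        have h1 := hd.hasDerivAt.eventually_ne (c := g x) hc
        have h2 : ∀ᶠ y in 𝓝[≠] x, |g y - g x| < 2 := by
          refine Eventually.filter_mono nhdsWithin_le_nhds ?_
          have := Metric.continuousAt_iff'.1 hd.continuousAt 2 (by norm_num)
          simpa [Real.dist_eq] using this
        refine hni ((h1.and h2).mono ?_)
        rintro y ⟨hy1, hy2⟩ hy
        rcases hg0 y hy with a | a <;> rcases hg0 x hux with b | b <;>
          rw [a, b] at hy1 hy2 <;> first | exact hy1 rfl | (norm_num at hy2)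
      rw [d1, d2]; simp

/-- The three seed functions `G¹ = ∫ e^{-2∫u}`, `G² = ∫ e^{2∫u}` and
`G³ = (∫ e^{-2∫u})·(∫ e^{2∫u})` lie in the kernel of the Lenard operator
`K·G = -(1/4)G''' + (u·(u·G')^{(-1)})'`, for suitable choices of the antiderivative
`(·)^{(-1)}` of `u·G'`. -/
theorem lenard_kernel_seeds
    (u U E₁ E₂ : ℝ → ℝ)
    (hu : ContDiff ℝ (⊤ : ℕ∞) u)
    (hU : ∀ x, deriv U x = u x)
    (hE₁ : ∀ x, deriv E₁ x = Real.exp (-(2 * U x)))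
    (hE₂ : ∀ x, deriv E₂ x = Real.exp (2 * U x)) :
    (∃ W : ℝ → ℝ, (∀ x, deriv W x = u x * deriv E₁ x) ∧
      ∀ x, -(1 / 4) * deriv (deriv (deriv E₁)) x
          + deriv (fun y => u y * W y) x = 0) ∧
    (∃ W : ℝ → ℝ, (∀ x, deriv W x = u x * deriv E₂ x) ∧
      ∀ x, -(1 / 4) * deriv (deriv (deriv E₂)) x
          + deriv (fun y => u y * W y) x = 0) ∧
    (∃ W : ℝ → ℝ, (∀ x, deriv W x = u x * deriv (fun y => E₁ y * E₂ y) x) ∧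
      ∀ x, -(1 / 4) * deriv (deriv (deriv (fun y => E₁ y * E₂ y))) x
          + deriv (fun y => u y * W y) x = 0) := by
  refine ⟨aux_first hU (-2) (by norm_num) (fun x => by rw [hE₁]; simp),
    aux_first hU 2 (by norm_num) hE₂, aux_third u U E₁ E₂ hu.continuous hU ?_ ?_⟩
  · intro x
    rw [← hE₁]
    exact (differentiableAt_of_deriv_ne_zero (by rw [hE₁]; exact (Real.exp_pos _).ne')).hasDerivAt
  · intro x
    rw [← Real.exp_neg, neg_neg, ← hE₂]
    exact (differentiableAt_of_deriv_ne_zero (by rw [hE₂]; exact (Real.exp_pos _).ne')).hasDerivAt
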